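/- Twisted Alexander group of a fibered presentation (forward direction of the fibering theorem, operators made explicit): let N be the normal closure in the derived group G_ρ of the set {x̄^γ : γ ∈ Γ}, where x̄ is the class of the stable letter x in G. Then the quotient G_ρ/N is a free group, freely generated by the images of the elements āᵢ^γ for 1 ≤ i ≤ n and γ ∈ Γ₀, where Γ₀ = Γ ∩ GL_m(R) is the set of elements of Γ of t-degree zero (equivalently, Γ₀ = P₂(ker P₁)). -/

import Mathlib

/-- The defining relators of Crowell's derived group of the permutation
representation associated to a right action `act` of `G` on `Γ`:
`(γ, g*h) * ((γ, g) * (γ·g, h))⁻¹` for `g, h ∈ G` and `γ ∈ Γ`. -/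
def derivedRels {Γ : Type*} {G : Type*} [Group G] (act : Γ → G → Γ) :
    Set (FreeGroup (Γ × G)) :=
  {r | ∃ (γ : Γ) (g h : G),
    r = FreeGroup.of (γ, g * h) *
      (FreeGroup.of (γ, g) * FreeGroup.of (act γ g, h))⁻¹}

/-- Crowell's derived group `G_ρ`. -/
def DerivedGroup {Γ : Type*} {G : Type*} [Group G] (act : Γ → G → Γ) :=
  PresentedGroup (derivedRels act)

instance {Γ : Type*} {G : Type*} [Group G] (act : Γ → G → Γ) :
    Group (DerivedGroup act) :=
  inferInstanceAs (Group (PresentedGroup (derivedRels act)))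

/-- The generator `g^γ` of the derived group. -/
def derivedGen {Γ : Type*} {G : Type*} [Group G] (act : Γ → G → Γ)
    (γ : Γ) (g : G) : DerivedGroup act :=
  PresentedGroup.of (rels := derivedRels act) (γ, g)

section Fibered

variable {n : ℕ}

/-- Relators `x·aᵢ·x⁻¹·φ(aᵢ)⁻¹` of the HNN presentation of the group of a
fibered knot: generators are `Option (Fin n)`, with stable letter `x = none`
and free fiber generators `aᵢ = some i`. -/
def hnnRels (φ : FreeGroup (Fin n) ≃* FreeGroup (Fin n)) :
    Set (FreeGroup (Option (Fin n))) :=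
  {w | ∃ i : Fin n,
    w = FreeGroup.of (none : Option (Fin n)) * FreeGroup.of (some i) *
        (FreeGroup.of (none : Option (Fin n)))⁻¹ *
        ((FreeGroup.lift fun j : Fin n => FreeGroup.of (some j : Option (Fin n)))
            (φ (FreeGroup.of i)))⁻¹}

/-- The group of the HNN (fibered) presentation. -/
def FiberedGroup (φ : FreeGroup (Fin n) ≃* FreeGroup (Fin n)) :=
  PresentedGroup (hnnRels φ)

instance (φ : FreeGroup (Fin n) ≃* FreeGroup (Fin n)) :
    Group (FiberedGroup φ) :=
  inferInstanceAs (Group (PresentedGroup (hnnRels φ)))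

end Fibered

/-- A group acts on functions out of itself by right translation. -/
def rightShift (L K : Type*) [Group L] [Group K] : L →* MulAut (L → K) where
  toFun l :=
    { toFun := fun f γ => f (γ * l)
      invFun := fun f γ => f (γ * l⁻¹)
      left_inv := fun f => by simp
      right_inv := fun f => by simp
      map_mul' := fun _ _ => rfl }
  map_one' := by ext; simp
  map_mul' a b := by ext; simp [mul_assoc]

@[simp]
theorem rightShift_apply {L K : Type*} [Group L] [Group K] (l : L) (f : L → K) (γ : L) :
    rightShift L K l f γ = f (γ * l) := rfl

theorem derivedGen_mul {Γ G : Type*} [Group G] (act : Γ → G → Γ) (γ : Γ) (g h : G) :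
    derivedGen act γ (g * h) = derivedGen act γ g * derivedGen act (act γ g) h := by
  have : (PresentedGroup.mk (derivedRels act)) (FreeGroup.of (γ, g * h) *
      (FreeGroup.of (γ, g) * FreeGroup.of (act γ g, h))⁻¹) = 1 :=
    PresentedGroup.one_of_mem ⟨γ, g, h, rfl⟩
  rw [map_mul, map_inv, map_mul, mul_inv_eq_one] at this
  exact this

/-- A crossed map on `Γ × G` induces a homomorphism on the derived group. -/
def derivedLift {Γ G H : Type*} [Group G] [Group H] (act : Γ → G → Γ) (d : Γ → G → H)
    (hd : ∀ γ g h, d γ (g * h) = d γ g * d (act γ g) h) : DerivedGroup act →* H :=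
  PresentedGroup.toGroup (rels := derivedRels act) (f := fun p => d p.1 p.2) (by
    rintro _ ⟨γ, g, h, rfl⟩
    simp [hd])

theorem derivedLift_derivedGen {Γ G H : Type*} [Group G] [Group H] (act : Γ → G → Γ)
    (d : Γ → G → H) (hd : ∀ γ g h, d γ (g * h) = d γ g * d (act γ g) h) (γ : Γ) (g : G) :
    derivedLift act d hd (derivedGen act γ g) = d γ g :=
  PresentedGroup.toGroup.of _

theorem closure_range_derivedGen {Γ G : Type*} [Group G] (act : Γ → G → Γ) :
    Subgroup.closure {z : DerivedGroup act | ∃ γ g, derivedGen act γ g = z} = ⊤ := by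
  have h : Subgroup.closure (Set.range fun p : Γ × G => derivedGen act p.1 p.2) = ⊤ :=
    PresentedGroup.closure_range_of (derivedRels act)
  rw [← h]
  congr 1
  ext z
  simp

namespace FiberedGroup

variable {n : ℕ} (φ : FreeGroup (Fin n) ≃* FreeGroup (Fin n))

/-- The stable letter. -/
def stable : FiberedGroup φ := PresentedGroup.of (rels := hnnRels φ) none

/-- The homomorphism from the free group of the fiber. -/
def fiber : FreeGroup (Fin n) →* FiberedGroup φ :=
  FreeGroup.lift fun i => (PresentedGroup.of (rels := hnnRels φ) (some i) : FiberedGroup φ)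

theorem fiber_of (i : Fin n) :
    fiber φ (FreeGroup.of i) = PresentedGroup.of (rels := hnnRels φ) (some i) :=
  FreeGroup.lift_apply_of

theorem mk_lift_some (w : FreeGroup (Fin n)) :
    PresentedGroup.mk (hnnRels φ)
      (FreeGroup.lift (fun j : Fin n => FreeGroup.of (some j : Option (Fin n))) w) =
      fiber φ w := by
  have : (PresentedGroup.mk (hnnRels φ)).comp
      (FreeGroup.lift fun j : Fin n => FreeGroup.of (some j : Option (Fin n))) = fiber φ := by
    refine FreeGroup.ext_hom _ _ fun i => ?_
    rw [MonoidHom.comp_apply, FreeGroup.lift_apply_of]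
    exact (fiber_of φ i).symm
  exact DFunLike.congr_fun this w

theorem fiber_apply_monodromy (w : FreeGroup (Fin n)) :
    fiber φ (φ w) = stable φ * fiber φ w * (stable φ)⁻¹ := by
  have : (fiber φ).comp φ.toMonoidHom =
      (MulAut.conj (stable φ)).toMonoidHom.comp (fiber φ) := by
    refine FreeGroup.ext_hom _ _ fun i => ?_
    have h : PresentedGroup.mk (hnnRels φ) _ = 1 := PresentedGroup.one_of_mem ⟨i, rfl⟩
    rw [map_mul, map_inv, mul_inv_eq_one, mk_lift_some] at h
    simp only [MonoidHom.comp_apply, MulEquiv.coe_toMonoidHom, fiber_of]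
    exact h.symm
  exact DFunLike.congr_fun this w

theorem fiber_apply_monodromy_zpow (k : ℤ) (w : FreeGroup (Fin n)) :
    fiber φ (((φ : MulAut (FreeGroup (Fin n))) ^ k) w) =
      stable φ ^ k * fiber φ w * (stable φ ^ k)⁻¹ := by
  induction k using Int.induction_on generalizing w with
  | zero => simp
  | succ k ih =>
    rw [zpow_add_one, MulAut.mul_apply, ih, fiber_apply_monodromy, zpow_add_one]
    group
  | pred k ih =>
    have h := fiber_apply_monodromy φ (φ.symm w)
    rw [MulEquiv.apply_symm_apply] at h
    rw [zpow_sub_one, MulAut.mul_apply, ih, MulAut.inv_apply, h, zpow_sub_one]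
    group

/-- The universal property of the HNN presentation. -/
def lift {H : Type*} [Group H] (f : FreeGroup (Fin n) →* H) (t : H)
    (h : ∀ w, f (φ w) = t * f w * t⁻¹) : FiberedGroup φ →* H :=
  PresentedGroup.toGroup (rels := hnnRels φ)
    (f := fun o => o.elim t fun i => f (FreeGroup.of i)) (by
    rintro _ ⟨i, rfl⟩
    have key : (FreeGroup.lift fun o : Option (Fin n) =>
        o.elim t fun i => f (FreeGroup.of i)).comp
        (FreeGroup.lift fun j : Fin n => FreeGroup.of (some j)) = f :=
      FreeGroup.ext_hom _ _ fun i => by simp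
    have := DFunLike.congr_fun key (φ (FreeGroup.of i))
    rw [MonoidHom.comp_apply] at this
    rw [map_mul, map_inv, this, h]
    simp)

theorem lift_stable {H : Type*} [Group H] (f : FreeGroup (Fin n) →* H) (t : H)
    (h : ∀ w, f (φ w) = t * f w * t⁻¹) : lift φ f t h (stable φ) = t :=
  PresentedGroup.toGroup.of _

theorem lift_fiber {H : Type*} [Group H] (f : FreeGroup (Fin n) →* H) (t : H)
    (h : ∀ w, f (φ w) = t * f w * t⁻¹) (w : FreeGroup (Fin n)) :
    lift φ f t h (fiber φ w) = f w := by
  have : (lift φ f t h).comp (fiber φ) = f := by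
    refine FreeGroup.ext_hom _ _ fun i => ?_
    rw [MonoidHom.comp_apply, fiber_of]
    exact PresentedGroup.toGroup.of _
  exact DFunLike.congr_fun this w

theorem closure_generators :
    Subgroup.closure (insert (stable φ) (Set.range (fiber φ))) = ⊤ := by
  have h : Subgroup.closure (G := FiberedGroup φ) (Set.range fun o : Option (Fin n) =>
      PresentedGroup.of (rels := hnnRels φ) o) = ⊤ :=
    PresentedGroup.closure_range_of (hnnRels φ)
  rw [eq_top_iff, ← h, Subgroup.closure_le]
  rintro _ ⟨_ | i, rfl⟩
  · exact Subgroup.subset_closure (Or.inl rfl)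
  · exact Subgroup.subset_closure (Or.inr ⟨FreeGroup.of i, fiber_of φ i⟩)

section Cocycle

variable {L K : Type*} [Group L] [Group K] (q : FiberedGroup φ →* L)
  (D : L →* Multiplicative ℤ) (e : L → Fin n → K)

/-- The crossed homomorphism of the fiber with prescribed values `e` on generators, paired
with `q`. -/
def fiberCrossed : FreeGroup (Fin n) →* (L → K) ⋊[rightShift L K] L :=
  FreeGroup.lift fun i => ⟨fun γ => e γ i, q (fiber φ (FreeGroup.of i))⟩

theorem fiberCrossed_right (w : FreeGroup (Fin n)) :
    (fiberCrossed φ q e w).right = q (fiber φ w) := by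
  have : SemidirectProduct.rightHom.comp (fiberCrossed φ q e) = q.comp (fiber φ) := by
    refine FreeGroup.ext_hom _ _ fun i => ?_
    simp [fiberCrossed]
  exact DFunLike.congr_fun this w

theorem fiberCrossed_mul_left (v w : FreeGroup (Fin n)) (γ : L) :
    (fiberCrossed φ q e (v * w)).left γ =
      (fiberCrossed φ q e v).left γ * (fiberCrossed φ q e w).left (γ * q (fiber φ v)) := by
  rw [map_mul, SemidirectProduct.mul_left, Pi.mul_apply, rightShift_apply, fiberCrossed_right]

theorem map_fiber_eq_one {H : Type*} [Group H] (f : FiberedGroup φ →* H)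
    (h : ∀ i, f (fiber φ (FreeGroup.of i)) = 1) (w : FreeGroup (Fin n)) :
    f (fiber φ w) = 1 := by
  have : f.comp (fiber φ) = 1 := FreeGroup.ext_hom _ _ h
  exact DFunLike.congr_fun this w

/-- The extension of `fiberCrossed` from degree zero to all degrees which is equivariant under
the monodromy. -/
def spreadCrossed (hD : ∀ w, D (q (fiber φ w)) = 1) :
    FreeGroup (Fin n) →* (L → K) ⋊[rightShift L K] L :=
  MonoidHom.mk' (fun w => ⟨fun γ =>
    (fiberCrossed φ q e (((φ : MulAut (FreeGroup (Fin n))) ^ (D γ).toAdd) w)).left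
      (γ * (q (stable φ) ^ (D γ).toAdd)⁻¹), q (fiber φ w)⟩) (by
    intro v w
    refine SemidirectProduct.ext (funext fun γ => ?_) (by simp)
    rw [SemidirectProduct.mul_left, Pi.mul_apply, rightShift_apply]
    simp only [map_mul D, hD, mul_one]
    rw [map_mul, fiberCrossed_mul_left, fiber_apply_monodromy_zpow]
    simp [mul_assoc])

theorem spreadCrossed_monodromy (hD : ∀ w, D (q (fiber φ w)) = 1)
    (hx : D (q (stable φ)) = Multiplicative.ofAdd 1) (w : FreeGroup (Fin n)) :
    spreadCrossed φ q D e hD (φ w) =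
      SemidirectProduct.inr (q (stable φ)) * spreadCrossed φ q D e hD w *
        (SemidirectProduct.inr (q (stable φ)))⁻¹ := by
  rw [← map_inv]
  refine SemidirectProduct.ext (funext fun γ => ?_) ?_
  · simp [spreadCrossed, hx, zpow_add_one, mul_assoc]
  · simp [spreadCrossed, fiber_apply_monodromy]

/-- The crossed homomorphism on the whole group, trivial on the stable letter. -/
def crossed (hD : ∀ w, D (q (fiber φ w)) = 1)
    (hx : D (q (stable φ)) = Multiplicative.ofAdd 1) :
    FiberedGroup φ →* (L → K) ⋊[rightShift L K] L :=
  lift φ (spreadCrossed φ q D e hD) (SemidirectProduct.inr (q (stable φ)))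
    (spreadCrossed_monodromy φ q D e hD hx)

variable (hD : ∀ w, D (q (fiber φ w)) = 1) (hx : D (q (stable φ)) = Multiplicative.ofAdd 1)

theorem crossed_right (g : FiberedGroup φ) : (crossed φ q D e hD hx g).right = q g := by
  have : SemidirectProduct.rightHom.comp (crossed φ q D e hD hx) = q := by
    refine MonoidHom.eq_of_eqOn_dense (closure_generators φ) ?_
    rintro _ (rfl | ⟨w, rfl⟩)
    · simp [crossed, lift_stable]
    · simp [crossed, lift_fiber, spreadCrossed]
  exact DFunLike.congr_fun this g

theorem crossed_mul_left (g h : FiberedGroup φ) (γ : L) :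
    (crossed φ q D e hD hx (g * h)).left γ =
      (crossed φ q D e hD hx g).left γ * (crossed φ q D e hD hx h).left (γ * q g) := by
  rw [map_mul, SemidirectProduct.mul_left, Pi.mul_apply, rightShift_apply, crossed_right]

theorem crossed_stable_left (γ : L) : (crossed φ q D e hD hx (stable φ)).left γ = 1 := by
  simp [crossed, lift_stable]

theorem crossed_fiber_left (γ : L) (hγ : D γ = 1) (i : Fin n) :
    (crossed φ q D e hD hx (fiber φ (FreeGroup.of i))).left γ = e γ i := by
  simp [crossed, lift_fiber, spreadCrossed, hγ, fiberCrossed]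

end Cocycle

section Crossed

variable {L Q : Type*} [Group L] [Group Q] (q : FiberedGroup φ →* L)
  (D : L →* Multiplicative ℤ) (d : L → FiberedGroup φ → Q)

theorem crossed_one (hd : ∀ γ g h, d γ (g * h) = d γ g * d (γ * q g) h) (γ : L) :
    d γ 1 = 1 := by
  simpa using hd γ 1 1

theorem crossed_inv (hd : ∀ γ g h, d γ (g * h) = d γ g * d (γ * q g) h) (γ : L)
    (g : FiberedGroup φ) : d γ g⁻¹ = (d (γ * q g⁻¹) g)⁻¹ := by
  rw [eq_inv_iff_mul_eq_one, ← hd, inv_mul_cancel, crossed_one φ q d hd]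

/-- The elements whose crossed values all lie in a given subgroup. -/
def crossedPreimage (hd : ∀ γ g h, d γ (g * h) = d γ g * d (γ * q g) h) (H : Subgroup Q) :
    Subgroup (FiberedGroup φ) where
  carrier := {g | ∀ γ, d γ g ∈ H}
  one_mem' γ := by rw [crossed_one φ q d hd]; exact H.one_mem
  mul_mem' hg hh γ := by rw [hd]; exact H.mul_mem (hg _) (hh _)
  inv_mem' hg γ := by rw [crossed_inv φ q d hd]; exact H.inv_mem (hg _)

theorem crossed_mem_of_degree_zero (hd : ∀ γ g h, d γ (g * h) = d γ g * d (γ * q g) h)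
    (hD : ∀ w, D (q (fiber φ w)) = 1)
    (hx : D (q (stable φ)) = Multiplicative.ofAdd 1)
    (hdx : ∀ γ, d γ (stable φ) = 1) (H : Subgroup Q)
    (hH : ∀ γ i, D γ = 1 → d γ (fiber φ (FreeGroup.of i)) ∈ H)
    (γ : L) (g : FiberedGroup φ) : d γ g ∈ H := by
  have hpow (k : ℤ) (γ : L) : d γ (stable φ ^ k) = 1 := by
    have : stable φ ∈ crossedPreimage φ q d hd ⊥ := fun γ => hdx γ
    exact zpow_mem this k γ
  have hfib (w : FreeGroup (Fin n)) : ∀ γ, D γ = 1 → d γ (fiber φ w) ∈ H := by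
    induction w using FreeGroup.induction_on with
    | C1 => intro γ _; rw [map_one, crossed_one φ q d hd]; exact H.one_mem
    | of i => exact fun γ => hH γ i
    | inv_of i ih =>
      intro γ hγ
      rw [map_inv, crossed_inv φ q d hd]
      exact H.inv_mem (ih _ (by simp [hγ, hD]))
    | mul v w hv hw =>
      intro γ hγ
      rw [map_mul, hd]
      exact H.mul_mem (hv γ hγ) (hw _ (by simp [hγ, hD]))
  suffices crossedPreimage φ q d hd H = ⊤ from (this ▸ Subgroup.mem_top g :
    g ∈ crossedPreimage φ q d hd H) γ
  rw [eq_top_iff, ← closure_generators, Subgroup.closure_le]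
  rintro _ (rfl | ⟨w, rfl⟩) γ
  · rw [hdx]; exact H.one_mem
  · have h := hfib (((φ : MulAut (FreeGroup (Fin n))) ^ (D γ).toAdd) w)
      (γ * (q (stable φ) ^ (D γ).toAdd)⁻¹) (by
        rw [map_mul, map_inv, map_zpow, hx, ← ofAdd_zsmul]; simp)
    rw [fiber_apply_monodromy_zpow, ← zpow_neg (stable φ), hd, hd, hpow, hpow] at h
    simpa using h

end Crossed

/-- Generalization of the fibering theorem to an arbitrary surjection onto a group graded by the
degree in the stable letter. -/
theorem derived_mod_stable_free {L : Type*} [Group L] (q : FiberedGroup φ →* L)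
    (D : L →* Multiplicative ℤ) (hD : ∀ w, D (q (fiber φ w)) = 1)
    (hx : D (q (stable φ)) = Multiplicative.ofAdd 1)
    (act : L → FiberedGroup φ → L) (hact : ∀ γ g, act γ g = γ * q g)
    (p : L → Prop) (hp : ∀ γ, p γ ↔ D γ = 1) :
    Function.Bijective (FreeGroup.lift fun s : {γ : L // p γ} × Fin n =>
      QuotientGroup.mk' (Subgroup.normalClosure
        {z : DerivedGroup act | ∃ γ : L, z = derivedGen act γ (stable φ)})
        (derivedGen act s.1.val (fiber φ (FreeGroup.of s.2)))) := by
  classical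
  set N := Subgroup.normalClosure
    {z : DerivedGroup act | ∃ γ : L, z = derivedGen act γ (stable φ)} with hN
  constructor
  · let e : L → Fin n → FreeGroup ({γ : L // p γ} × Fin n) := fun γ i =>
      if h : p γ then FreeGroup.of (⟨γ, h⟩, i) else 1
    let θ := derivedLift act (fun γ g => (crossed φ q D e hD hx g).left γ)
      (fun γ g h => by rw [hact, crossed_mul_left])
    have hθ : N ≤ θ.ker := by
      refine Subgroup.normalClosure_le_normal ?_
      rintro _ ⟨γ, rfl⟩
      exact (derivedLift_derivedGen _ _ _ _ _).trans (crossed_stable_left _ _ _ _ _ _ _)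
    refine Function.LeftInverse.injective (g := QuotientGroup.lift N θ hθ) fun w => ?_
    have : (QuotientGroup.lift N θ hθ).comp (FreeGroup.lift fun s : {γ : L // p γ} × Fin n =>
        QuotientGroup.mk' N (derivedGen act s.1.val (fiber φ (FreeGroup.of s.2)))) =
        MonoidHom.id _ := by
      refine FreeGroup.ext_hom _ _ fun s => ?_
      rw [MonoidHom.comp_apply, FreeGroup.lift_apply_of, QuotientGroup.mk'_apply,
        QuotientGroup.lift_mk, derivedLift_derivedGen,
        crossed_fiber_left _ _ _ _ _ _ _ ((hp _).1 s.1.2)]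
      exact dif_pos s.1.2
    exact DFunLike.congr_fun this w
  · rw [← MonoidHom.range_eq_top, eq_top_iff,
      ← MonoidHom.range_eq_top.2 (QuotientGroup.mk'_surjective N), MonoidHom.range_eq_map,
      ← closure_range_derivedGen, MonoidHom.map_closure, Subgroup.closure_le]
    rintro _ ⟨_, ⟨γ, g, rfl⟩, rfl⟩
    refine crossed_mem_of_degree_zero φ q D (fun γ g => QuotientGroup.mk' N (derivedGen act γ g))
      ?_ hD hx ?_ _ ?_ γ g
    · intro γ g h
      rw [derivedGen_mul, hact, map_mul]
    · intro γ
      rw [QuotientGroup.mk'_apply, QuotientGroup.eq_one_iff]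
      exact Subgroup.subset_normalClosure ⟨γ, rfl⟩
    · intro γ i hγ
      exact ⟨FreeGroup.of (⟨γ, (hp γ).2 hγ⟩, i), FreeGroup.lift_apply_of⟩

end FiberedGroup

/-- A monomial equal to `1` has degree zero. -/
theorem LaurentPolynomial.eq_zero_of_T_mul_C_eq_one {R : Type*} [CommRing R] [Nontrivial R]
    {k : ℤ} {a : R} (h : T (R := R) k * C a = 1) : k = 0 := by
  rw [mul_comm, ← single_eq_C_mul_T, AddMonoidAlgebra.one_def] at h
  by_contra hk
  have := congrArg (fun f : LaurentPolynomial R => f.coeff 0) h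
  simp only [AddMonoidAlgebra.coeff_single, Finsupp.single_apply, hk] at this
  simp at this

section Fibered

variable {n : ℕ}

/-- Forward direction of the fibering theorem, operators made explicit: for a
fibered presentation, the twisted Alexander group modulo the normal closure of
the orbit of the stable letter is a free group, freely generated by the images
of the `āᵢ^γ` with `γ ∈ Γ₀ = P₂(ker P₁)`, the elements of `Γ` of `t`-degree
zero. -/
theorem twisted_alexander_group_of_fibered_mod_meridian_free
    {R : Type*} [CommRing R] [IsDomain R] {m : ℕ} (hm : 1 ≤ m) (hn : 1 ≤ n)
    (φ : FreeGroup (Fin n) ≃* FreeGroup (Fin n))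
    (P₁ : FiberedGroup φ →* Multiplicative ℤ)
    (hP₁x : P₁ (PresentedGroup.of (rels := hnnRels φ) none) = Multiplicative.ofAdd 1)
    (hP₁a : ∀ i : Fin n, P₁ (PresentedGroup.of (rels := hnnRels φ) (some i)) = 1)
    (P₂ : FiberedGroup φ →* Matrix.GeneralLinearGroup (Fin m) R)
    (P : FiberedGroup φ →* Matrix.GeneralLinearGroup (Fin m) (LaurentPolynomial R))
    (hP : ∀ g : FiberedGroup φ,
      (P g : Matrix (Fin m) (Fin m) (LaurentPolynomial R))
        = LaurentPolynomial.T (R := R) (Multiplicative.toAdd (P₁ g)) •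
          ((P₂ g : Matrix (Fin m) (Fin m) R).map
            (algebraMap R (LaurentPolynomial R))))
    (act : P.range → FiberedGroup φ → P.range)
    (hact : ∀ (γ : P.range) (g : FiberedGroup φ),
      (act γ g : Matrix.GeneralLinearGroup (Fin m) (LaurentPolynomial R))
        = (γ : Matrix.GeneralLinearGroup (Fin m) (LaurentPolynomial R)) * P g) :
    Function.Bijective
      (FreeGroup.lift
        (fun p : {γ : P.range // ∃ g ∈ P₁.ker, P g = (γ : _)} × Fin n =>
          (QuotientGroup.mk'
            (Subgroup.normalClosure
              {z : DerivedGroup act | ∃ γ : P.range,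
                z = derivedGen act γ (PresentedGroup.of (rels := hnnRels φ) none)}))
            (derivedGen act p.1.val
              (PresentedGroup.of (rels := hnnRels φ) (some p.2))))) := by
  let q := P.rangeRestrict
  have hq : Function.Surjective q := P.rangeRestrict_surjective
  have hker : q.ker ≤ P₁.ker := by
    intro g hg
    rw [MonoidHom.ker_rangeRestrict, MonoidHom.mem_ker] at hg
    have h := hP g
    rw [hg] at h
    have h0 := congrFun (congrFun h ⟨0, hm⟩) ⟨0, hm⟩
    simp only [Units.val_one, Matrix.one_apply_eq, Matrix.smul_apply, Matrix.map_apply,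
      smul_eq_mul] at h0
    exact Multiplicative.toAdd.injective (LaurentPolynomial.eq_zero_of_T_mul_C_eq_one h0.symm)
  let D : P.range →* Multiplicative ℤ := q.liftOfSurjective hq ⟨P₁, hker⟩
  have hDq (g : FiberedGroup φ) : D (q g) = P₁ g :=
    MonoidHom.liftOfRightInverse_comp_apply _ _ _ _ _
  have hx : D (q (FiberedGroup.stable φ)) = Multiplicative.ofAdd 1 := (hDq _).trans hP₁x
  have hD (w : FreeGroup (Fin n)) : D (q (FiberedGroup.fiber φ w)) = 1 := by
    rw [hDq]
    exact FiberedGroup.map_fiber_eq_one φ P₁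
      (fun i => by rw [FiberedGroup.fiber_of]; exact hP₁a i) w
  have h := FiberedGroup.derived_mod_stable_free φ q D hD hx act
    (fun γ g => Subtype.ext (hact γ g))
    (fun γ => ∃ g ∈ P₁.ker, P g = (γ : Matrix.GeneralLinearGroup (Fin m) (LaurentPolynomial R)))
    (fun γ => by
      obtain ⟨g, rfl⟩ := hq γ
      rw [hDq]
      constructor
      · rintro ⟨g', hg', h⟩
        rw [← hDq g, ← show q g' = q g from Subtype.ext h, hDq]
        exact hg'
      · exact fun hg => ⟨g, hg, rfl⟩)
  simp only [FiberedGroup.fiber_of] at h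
  exact h

end Fibered
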